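/- Binet-type closed form for the block sums of the rule 150 total activity: for every n : ℕ, (S(n) : ℝ) = (2^n / √5) · ( ((1+√5)/2)^(n+2) − ((1−√5)/2)^(n+2) ). -/

import Mathlib

/-- Rule 150 elementary cellular automaton, started from a single seed at the origin. -/
def rule150 : ℕ → ℤ → ZMod 2
  | 0, n => if n = 0 then 1 else 0
  | t + 1, n => rule150 t (n - 1) + rule150 t n + rule150 t (n + 1)

/-- Total activity: the number of active sites at time `t`. -/
noncomputable def totalActivity (t : ℕ) : ℕ := {n : ℤ | rule150 t n = 1}.ncard

/-- Block sum of the total activity over the first `2 ^ n` time steps. -/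
noncomputable def blockSum (n : ℕ) : ℕ := ∑ i ∈ Finset.range (2 ^ n), totalActivity i

theorem rule150_succ (t : ℕ) (n : ℤ) :
    rule150 (t + 1) n = rule150 t (n - 1) + rule150 t n + rule150 t (n + 1) := rfl

theorem rule150_eq_zero (t : ℕ) (n : ℤ) (h : (t : ℤ) < |n|) : rule150 t n = 0 := by
  induction t generalizing n with
  | zero =>
    have : n ≠ 0 := by simpa using h
    simp [rule150, this]
  | succ t ih =>
    push_cast at h
    rw [rule150_succ, ih, ih, ih] <;> grind

theorem finite_rule150_diff (t : ℕ) : {n : ℤ | rule150 t n + rule150 t (n + 1) = 1}.Finite := by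
  refine (Set.finite_Icc (-(t : ℤ) - 1) t).subset fun n hn => ?_
  by_contra hc
  rw [Set.mem_Icc] at hc
  rw [Set.mem_ofPred_eq, rule150_eq_zero t n (by grind),
    rule150_eq_zero t (n + 1) (by grind)] at hn
  simp at hn

theorem finite_rule150 (t : ℕ) : {n : ℤ | rule150 t n = 1}.Finite := by
  refine (Set.finite_Icc (-(t : ℤ)) t).subset fun n hn => ?_
  by_contra hc
  rw [Set.mem_Icc] at hc
  rw [Set.mem_ofPred_eq, rule150_eq_zero t n (by grind)] at hn
  simp at hn

/-- Over `ZMod 2`, the square of the rule 150 update spreads to distance two only. -/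
theorem rule150_add_two (t : ℕ) (n : ℤ) :
    rule150 (t + 2) n = rule150 t (n - 2) + rule150 t n + rule150 t (n + 2) := by
  have e1 : n - 1 - 1 = n - 2 := by ring
  have e2 : n + 1 + 1 = n + 2 := by ring
  rw [rule150_succ (t + 1), rule150_succ, rule150_succ, rule150_succ, e1, e2,
    sub_add_cancel, add_sub_cancel_right]
  generalize rule150 t (n - 2) = a
  generalize rule150 t (n - 1) = b
  generalize rule150 t n = c
  generalize rule150 t (n + 1) = d
  generalize rule150 t (n + 2) = e
  revert a b c d e
  decide

theorem rule150_two_mul (t : ℕ) (n : ℤ) :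
    rule150 (2 * t) (2 * n) = rule150 t n ∧ rule150 (2 * t) (2 * n + 1) = 0 := by
  induction t generalizing n with
  | zero =>
    have : 2 * n + 1 ≠ 0 := by omega
    simp [rule150, this]
  | succ t ih =>
    have e1 : 2 * n - 2 = 2 * (n - 1) := by ring
    have e2 : 2 * n + 2 = 2 * (n + 1) := by ring
    have e3 : 2 * n + 1 - 2 = 2 * (n - 1) + 1 := by ring
    have e4 : 2 * n + 1 + 2 = 2 * (n + 1) + 1 := by ring
    rw [mul_add_one, rule150_add_two, rule150_add_two, e1, e2, e3, e4]
    simp [ih, rule150_succ]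

theorem rule150_two_mul_add_one_even (t : ℕ) (n : ℤ) :
    rule150 (2 * t + 1) (2 * n) = rule150 t n := by
  have e : 2 * n - 1 = 2 * (n - 1) + 1 := by ring
  rw [rule150_succ, e]
  simp [rule150_two_mul]

theorem rule150_two_mul_add_one_odd (t : ℕ) (n : ℤ) :
    rule150 (2 * t + 1) (2 * n + 1) = rule150 t n + rule150 t (n + 1) := by
  have e : 2 * n + 1 + 1 = 2 * (n + 1) := by ring
  rw [rule150_succ, e]
  simp [rule150_two_mul]

theorem Int.ncard_setOf_even_add_odd {p : ℤ → Prop} (hp : {n | p n}.Finite) :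
    {n | p n}.ncard = {n | p (2 * n)}.ncard + {n | p (2 * n + 1)}.ncard := by
  have he : Function.Injective fun n : ℤ => 2 * n := fun a b h => by simpa using h
  have ho : Function.Injective fun n : ℤ => 2 * n + 1 := fun a b h => by simpa using h
  have hE : {n | p (2 * n)}.Finite := hp.preimage he.injOn
  have hO : {n | p (2 * n + 1)}.Finite := hp.preimage ho.injOn
  rw [← Set.ncard_image_of_injective {n | p (2 * n)} he,
    ← Set.ncard_image_of_injective {n | p (2 * n + 1)} ho,
    ← Set.ncard_union_eq _ (hE.image _) (hO.image _)]
  · congr 1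
    ext n
    simp only [Set.mem_ofPred_eq, Set.mem_union, Set.mem_image]
    constructor
    · intro h
      rcases Int.even_or_odd' n with ⟨k, rfl | rfl⟩
      · exact Or.inl ⟨k, h, rfl⟩
      · exact Or.inr ⟨k, h, rfl⟩
    · rintro (⟨k, h, rfl⟩ | ⟨k, h, rfl⟩) <;> exact h
  · rw [Set.disjoint_left]
    rintro _ ⟨a, -, rfl⟩ ⟨b, -, h⟩
    simp only at h
    omega

/-- The number of boundaries between active and inactive sites at time `t`. -/
noncomputable def totalBoundary (t : ℕ) : ℕ :=
  {n : ℤ | rule150 t n + rule150 t (n + 1) = 1}.ncard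

theorem ncard_rule150_shift (t : ℕ) :
    {n : ℤ | rule150 t (n + 1) = 1}.ncard = totalActivity t := by
  rw [totalActivity,
    ← Set.ncard_image_of_injective {n : ℤ | rule150 t (n + 1) = 1} (add_left_injective (1 : ℤ))]
  congr 1
  ext n
  simp

theorem totalActivity_two_mul (t : ℕ) : totalActivity (2 * t) = totalActivity t := by
  rw [totalActivity, Int.ncard_setOf_even_add_odd (finite_rule150 _)]
  simp [rule150_two_mul, totalActivity]

theorem totalActivity_two_mul_add_one (t : ℕ) :
    totalActivity (2 * t + 1) = totalActivity t + totalBoundary t := by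
  rw [totalActivity, Int.ncard_setOf_even_add_odd (finite_rule150 _)]
  simp [rule150_two_mul_add_one_even, rule150_two_mul_add_one_odd, totalActivity, totalBoundary]

theorem totalBoundary_two_mul (t : ℕ) : totalBoundary (2 * t) = 2 * totalActivity t := by
  have e (n : ℤ) : 2 * n + 1 + 1 = 2 * (n + 1) := by ring
  rw [totalBoundary, Int.ncard_setOf_even_add_odd (finite_rule150_diff _)]
  simp only [e, rule150_two_mul, add_zero, zero_add, ncard_rule150_shift]
  rw [← totalActivity, two_mul]

theorem totalBoundary_two_mul_add_one (t : ℕ) :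
    totalBoundary (2 * t + 1) = 2 * totalActivity t := by
  have e (n : ℤ) : 2 * n + 1 + 1 = 2 * (n + 1) := by ring
  have h1 (a b : ZMod 2) : a + (a + b) = b := by revert a b; decide
  have h2 (a b : ZMod 2) : a + b + b = a := by revert a b; decide
  rw [totalBoundary, Int.ncard_setOf_even_add_odd (finite_rule150_diff _)]
  simp only [e, rule150_two_mul_add_one_even, rule150_two_mul_add_one_odd, h1, h2,
    ncard_rule150_shift]
  rw [← totalActivity, two_mul]

theorem Finset.sum_range_two_mul_eq {M : Type*} [AddCommMonoid M] (f : ℕ → M) (m : ℕ) :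
    ∑ i ∈ Finset.range (2 * m), f i = ∑ i ∈ Finset.range m, (f (2 * i) + f (2 * i + 1)) := by
  induction m with
  | zero => simp
  | succ m ih =>
    rw [mul_add_one, Finset.sum_range_succ, Finset.sum_range_succ, ih, Finset.sum_range_succ,
      add_assoc]

theorem blockSum_succ (n : ℕ) :
    blockSum (n + 1) = 2 * blockSum n + ∑ i ∈ Finset.range (2 ^ n), totalBoundary i := by
  rw [blockSum, blockSum, pow_succ', Finset.sum_range_two_mul_eq, Finset.mul_sum,
    ← Finset.sum_add_distrib]
  refine Finset.sum_congr rfl fun i _ => ?_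
  rw [totalActivity_two_mul, totalActivity_two_mul_add_one]
  ring

theorem sum_totalBoundary_succ (n : ℕ) :
    ∑ i ∈ Finset.range (2 ^ (n + 1)), totalBoundary i = 4 * blockSum n := by
  rw [blockSum, pow_succ', Finset.sum_range_two_mul_eq, Finset.mul_sum]
  refine Finset.sum_congr rfl fun i _ => ?_
  rw [totalBoundary_two_mul, totalBoundary_two_mul_add_one]
  ring

theorem blockSum_zero : blockSum 0 = 1 := by
  simp [blockSum, totalActivity, rule150]

theorem sum_totalBoundary_zero :
    ∑ i ∈ Finset.range (2 ^ 0), totalBoundary i = 2 := by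
  have h : {n : ℤ | rule150 0 n + rule150 0 (n + 1) = 1} = {0, -1} := by
    ext n
    by_cases h0 : n = 0
    · simp [rule150, h0]
    · by_cases h1 : n = -1
      · simp [rule150, h1]
      · have : n + 1 ≠ 0 := by omega
        simp [rule150, h0, h1, this]
  simp [totalBoundary, h]

theorem blockSum_eq_fib (n : ℕ) : blockSum n = 2 ^ n * Nat.fib (n + 2) := by
  induction n using Nat.twoStepInduction with
  | zero => simp [blockSum_zero]
  | one => rw [blockSum_succ, sum_totalBoundary_zero, blockSum_zero]; rfl
  | more n ih₀ ih₁ =>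
    rw [blockSum_succ, sum_totalBoundary_succ, ih₁, ih₀, Nat.fib_add_two (n := n + 2)]
    ring

theorem blockSum_binet (n : ℕ) :
    (blockSum n : ℝ)
      = (2 ^ n / Real.sqrt 5)
        * (((1 + Real.sqrt 5) / 2) ^ (n + 2) - ((1 - Real.sqrt 5) / 2) ^ (n + 2)) := by
  rw [blockSum_eq_fib]
  push_cast
  rw [Real.coe_fib_eq, Real.goldenRatio, Real.goldenConj]
  ring
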